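/- arXiv:2505.13640 — 4 statements merged into one kernel-verified Lean document; each statement's English description precedes it below -/
import Mathlib

section
/- Let W : Fin 7 × Fin 7 → Bool be a 2-dimensional binary word in which every filled cell has at most 2 filled orthogonal neighbors. Then W has at most 34 filled cells (i.e., 2·49/3 + 4/3 = 34), and this bound is attained. -/
abbrev cellAdj {h w : ℕ} (p q : Fin h × Fin w) : Prop :=
  (p.1 = q.1 ∧ (p.2.val + 1 = q.2.val ∨ q.2.val + 1 = p.2.val)) ∨
  (p.2 = q.2 ∧ (p.1.val + 1 = q.1.val ∨ q.1.val + 1 = p.1.val))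

/-- number of filled orthogonal neighbors of `p` -/
def degW {h w : ℕ} (W : Fin h × Fin w → Bool) (p : Fin h × Fin w) : ℕ :=
  (Finset.univ.filter (fun q => cellAdj p q ∧ W q = true)).card

/-- every filled cell has at most `d` filled orthogonal neighbors -/
def degLEW {h w : ℕ} (W : Fin h × Fin w → Bool) (d : ℕ) : Prop :=
  ∀ p, W p = true → degW W p ≤ d

/-- number of filled cells -/
def filledCount {h w : ℕ} (W : Fin h × Fin w → Bool) : ℕ :=
  (Finset.univ.filter (fun p => W p = true)).card

/-- no cell of row `b` has three filled neighbours, with rows `a` above and `c` below (bit masks) -/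
def rowOk (a b c : ℕ) : Bool :=
  Nat.beq (Nat.land b (Nat.lor
    (Nat.land (Nat.land (Nat.shiftLeft b 1) (Nat.shiftRight b 1)) (Nat.lor a c))
    (Nat.land (Nat.land a c) (Nat.lor (Nat.shiftLeft b 1) (Nat.shiftRight b 1))))) 0

def popc (c : ℕ) : ℕ :=
  c % 2 + c / 2 % 2 + c / 4 % 2 + c / 8 % 2 + c / 16 % 2 + c / 32 % 2 + c / 64 % 2

/-- upper bounds for `k` consecutive rows -/
def capB : ℕ → ℕ
  | 0 => 0
  | 1 => 7
  | 2 => 11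
  | 3 => 16
  | 4 => 20
  | 5 => 25
  | 6 => 30
  | _ => 34

/-- `p c` holds for all `c < n` -/
def allBelow (p : ℕ → Bool) : ℕ → Bool
  | 0 => true
  | n + 1 => p n && allBelow p n

/-- true only if `k` further rows below rows `a`, `b` have total less than `need` -/
def rowSearch : ℕ → ℕ → ℕ → ℕ → Bool
  | 0, _, _, need => Nat.blt 0 need
  | k + 1, a, b, need =>
    allBelow (fun c => Nat.blt (capB k + popc c) need || (!rowOk a b c || (!rowOk b c 0 ||
      rowSearch k b c (need - popc c)))) 128

theorem allBelow_spec (p : ℕ → Bool) (n : ℕ) (h : allBelow p n = true) (c : ℕ) (hc : c < n) :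
    p c = true := by
  induction n with
  | zero => omega
  | succ n ih =>
    simp only [allBelow, Bool.and_eq_true] at h
    rcases Nat.lt_succ_iff_lt_or_eq.mp hc with h1 | rfl
    · exact ih h.2 h1
    · exact h.1

theorem rowSearch_sound (r : ℕ → ℕ) (hr : ∀ i, r i < 128)
    (h3 : ∀ i, rowOk (r i) (r (i + 1)) (r (i + 2)) = true)
    (h2 : ∀ i, rowOk (r i) (r (i + 1)) 0 = true) (K : ℕ) :
    ∀ k ≤ K, (∀ k < K, ∀ i, ∑ j ∈ Finset.range k, popc (r (i + j)) ≤ capB k) →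
    ∀ a b need i, rowSearch k a b need = true → rowOk a b (r i) = true →
      rowOk b (r i) 0 = true → rowOk b (r i) (r (i + 1)) = true →
      ∑ j ∈ Finset.range k, popc (r (i + j)) < need := by
  intro k
  induction k with
  | zero =>
    intro _ _ a b need i h _ _ _
    simpa [rowSearch, Nat.blt_eq] using h
  | succ k ih =>
    intro hk hcap a b need i h t1 t2 t3
    have hs := allBelow_spec _ _ h (r i) (hr i)
    simp only [t1, t2, Bool.or_eq_true, Nat.blt_eq, Bool.not_true, Bool.false_eq_true,
      false_or] at hs
    rw [Finset.sum_range_succ']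
    have e : ∑ j ∈ Finset.range k, popc (r (i + (j + 1))) =
        ∑ j ∈ Finset.range k, popc (r (i + 1 + j)) :=
      Finset.sum_congr rfl fun j _ => by rw [show i + (j + 1) = i + 1 + j by omega]
    rw [e, show i + 0 = i from rfl]
    rcases hs with hs | hs
    · have := hcap k (by omega) (i + 1)
      omega
    · have := ih (by omega) hcap _ _ _ (i + 1) hs t3 (h2 i) (h3 i)
      omega

theorem search1 : rowSearch 1 0 0 8 = true := by decide +kernel
theorem search2 : rowSearch 2 0 0 12 = true := by decide +kernel
theorem search3 : rowSearch 3 0 0 17 = true := by decide +kernel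
theorem search4 : rowSearch 4 0 0 21 = true := by decide +kernel
theorem search5 : rowSearch 5 0 0 26 = true := by decide +kernel
theorem search6 : rowSearch 6 0 0 31 = true := by decide +kernel
theorem search7 : rowSearch 7 0 0 35 = true := by decide +kernel

theorem rows_bound (r : ℕ → ℕ) (hr : ∀ i, r i < 128)
    (h3 : ∀ i, rowOk (r i) (r (i + 1)) (r (i + 2)) = true)
    (h2 : ∀ i, rowOk (r i) (r (i + 1)) 0 = true)
    (h1 : ∀ i, rowOk 0 (r i) (r (i + 1)) = true)
    (h0 : ∀ i, rowOk 0 (r i) 0 = true) :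
    ∀ k ≤ 7, ∀ i, ∑ j ∈ Finset.range k, popc (r (i + j)) ≤ capB k := by
  intro k
  induction k using Nat.strong_induction_on with
  | _ k ih =>
    intro hk i
    have hs : rowSearch k 0 0 (capB k + 1) = true := by
      interval_cases k
      · decide
      · exact search1
      · exact search2
      · exact search3
      · exact search4
      · exact search5
      · exact search6
      · exact search7
    have := rowSearch_sound r hr h3 h2 k k le_rfl (fun k' hk' i => ih k' hk' (by omega) i)
      0 0 _ i hs (by simp [rowOk]) (h0 i) (h1 i)
    omega

theorem rowOk_of (a b c : ℕ)
    (h : ∀ j, b.testBit j = true →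
      (a.testBit j).toNat + (c.testBit j).toNat + (decide (1 ≤ j) && b.testBit (j - 1)).toNat
        + (b.testBit (j + 1)).toNat ≤ 2) : rowOk a b c = true := by
  have : b &&& (((b <<< 1 &&& b >>> 1) &&& (a ||| c)) ||| ((a &&& c) &&& (b <<< 1 ||| b >>> 1))) = 0 := by
    apply Nat.eq_of_testBit_eq
    intro j
    have := h j
    simp only [Nat.testBit_and, Nat.testBit_or, Nat.testBit_shiftLeft, Nat.testBit_shiftRight,
      Nat.zero_testBit, ge_iff_le, Nat.add_comm 1 j]
    revert this
    generalize b.testBit j = x1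
    generalize a.testBit j = x2
    generalize c.testBit j = x3
    generalize (decide (1 ≤ j) && b.testBit (j - 1)) = x4
    generalize b.testBit (j + 1) = x5
    revert x1 x2 x3 x4 x5
    decide
  exact (congrArg (fun t => Nat.beq t 0) this :)

def wpad (W : Fin 7 × Fin 7 → Bool) (i j : ℕ) : Bool :=
  if h : i < 7 ∧ j < 7 then W (⟨i, h.1⟩, ⟨j, h.2⟩) else false

def wrow (W : Fin 7 × Fin 7 → Bool) (i : ℕ) : ℕ := Nat.ofBits (fun j : Fin 7 => wpad W i j)

theorem wrow_testBit (W : Fin 7 × Fin 7 → Bool) (i j : ℕ) :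
    (wrow W i).testBit j = wpad W i j := by
  by_cases hj : j < 7
  · simp [wrow, Nat.testBit_ofBits_lt, hj]
  · rw [wrow, Nat.testBit_ofBits_ge _ _ (by omega)]
    simp [wpad, hj]

theorem wpad_le (W : Fin 7 × Fin 7 → Bool) (a b : ℕ) (P : Fin 7 × Fin 7 → Prop)
    [DecidablePred P] (hP : ∀ q : Fin 7 × Fin 7, q.1.val = a → q.2.val = b → P q) :
    (wpad W a b).toNat ≤ ∑ q, if P q ∧ W q = true then 1 else 0 := by
  by_cases h : a < 7 ∧ b < 7
  · refine le_trans ?_ (Finset.single_le_sum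
      (f := fun q : Fin 7 × Fin 7 => if P q ∧ W q = true then 1 else 0)
      (fun _ _ => Nat.zero_le _) (Finset.mem_univ (⟨a, h.1⟩, ⟨b, h.2⟩)))
    have := hP (⟨a, h.1⟩, ⟨b, h.2⟩) rfl rfl
    simp only [wpad, h, and_self, dite_true, this, true_and]
    cases W (⟨a, h.1⟩, ⟨b, h.2⟩) <;> simp
  · simp [wpad, h]

theorem wpad_deg (W : Fin 7 × Fin 7 → Bool) (hW : degLEW W 2) (i j : ℕ)
    (h : wpad W i j = true) :
    (decide (1 ≤ i) && wpad W (i - 1) j).toNat + (wpad W (i + 1) j).toNat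
      + (decide (1 ≤ j) && wpad W i (j - 1)).toNat + (wpad W i (j + 1)).toNat ≤ 2 := by
  have hij : i < 7 ∧ j < 7 := by
    by_contra hn
    simp [wpad, hn] at h
  have hw : W (⟨i, hij.1⟩, ⟨j, hij.2⟩) = true := by simpa [wpad, hij] using h
  have hd := hW _ hw
  rw [degW, Finset.card_filter] at hd
  have e1 : (decide (1 ≤ i) && wpad W (i - 1) j).toNat ≤
      ∑ q : Fin 7 × Fin 7, if (q.1.val + 1 = i ∧ q.2.val = j) ∧ W q = true then 1 else 0 := by
    by_cases h1 : 1 ≤ i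
    · simp only [h1, decide_true, Bool.true_and]
      exact wpad_le W _ _ _ (fun q _ _ => by omega)
    · simp [h1]
  have e2 : (decide (1 ≤ j) && wpad W i (j - 1)).toNat ≤
      ∑ q : Fin 7 × Fin 7, if (q.1.val = i ∧ q.2.val + 1 = j) ∧ W q = true then 1 else 0 := by
    by_cases h1 : 1 ≤ j
    · simp only [h1, decide_true, Bool.true_and]
      exact wpad_le W _ _ _ (fun q _ _ => by omega)
    · simp [h1]
  have e3 := wpad_le W (i + 1) j (fun q => q.1.val = i + 1 ∧ q.2.val = j)
    (fun q h1 h2 => ⟨h1, h2⟩)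
  have e4 := wpad_le W i (j + 1) (fun q => q.1.val = i ∧ q.2.val = j + 1)
    (fun q h1 h2 => ⟨h1, h2⟩)
  refine le_trans (add_le_add (add_le_add (add_le_add e1 e3) e2) e4) (le_trans ?_ hd)
  rw [← Finset.sum_add_distrib, ← Finset.sum_add_distrib, ← Finset.sum_add_distrib]
  refine Finset.sum_le_sum fun q _ => ?_
  simp only [cellAdj, Fin.ext_iff]
  by_cases hq : W q = true
  · simp only [hq, and_true]
    split_ifs <;> omega
  · simp [hq]

theorem stmt11 :
    (∀ W : Fin 7 × Fin 7 → Bool, degLEW W 2 → filledCount W ≤ 34) ∧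
    (∃ W : Fin 7 × Fin 7 → Bool, degLEW W 2 ∧ filledCount W = 34) := by
  constructor
  · intro W hW
    have key : ∀ i x y, (x = 0 ∨ (1 ≤ i ∧ x = wrow W (i - 1))) → (y = 0 ∨ y = wrow W (i + 1)) →
        rowOk x (wrow W i) y = true := by
      intro i x y hx hy
      apply rowOk_of
      intro j hj
      simp only [wrow_testBit] at hj ⊢
      have := wpad_deg W hW i j hj
      have ex : (x.testBit j).toNat ≤ (decide (1 ≤ i) && wpad W (i - 1) j).toNat := by
        rcases hx with rfl | ⟨h1, rfl⟩
        · simp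
        · simp [wrow_testBit, h1]
      have ey : (y.testBit j).toNat ≤ (wpad W (i + 1) j).toNat := by
        rcases hy with rfl | rfl
        · simp
        · simp [wrow_testBit]
      omega
    have hb := rows_bound (wrow W) (fun i => Nat.ofBits_lt_two_pow _)
      (fun i => key (i + 1) _ _ (Or.inr ⟨by omega, rfl⟩) (Or.inr rfl))
      (fun i => key (i + 1) _ _ (Or.inr ⟨by omega, rfl⟩) (Or.inl rfl))
      (fun i => key i _ _ (Or.inl rfl) (Or.inr rfl))
      (fun i => key i _ _ (Or.inl rfl) (Or.inl rfl)) 7 le_rfl 0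
    have hp : ∀ i : Fin 7, popc (wrow W i) = ∑ j : Fin 7, (W (i, j)).toNat := by
      intro i
      have e : ∀ j : Fin 7, (W (i, j)).toNat = wrow W i / 2 ^ (j : ℕ) % 2 := by
        intro j
        rw [← Nat.toNat_testBit, wrow_testBit]
        simp [wpad]
      simp only [e, Fin.sum_univ_seven]
      simp [popc]
    have hf : filledCount W = ∑ i ∈ Finset.range 7, popc (wrow W (0 + i)) := by
      rw [filledCount, Finset.card_filter, Fintype.sum_prod_type, Finset.sum_range]
      refine Finset.sum_congr rfl fun i _ => ?_
      rw [Nat.zero_add, hp]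
      refine Finset.sum_congr rfl fun j _ => ?_
      cases W (i, j) <;> rfl
    rw [hf]
    exact hb
  · refine ⟨fun p => ([55, 109, 91, 54, 109, 89, 119].getD p.1.val 0).testBit p.2.val, ?_, ?_⟩
    · unfold degLEW degW
      decide +kernel
    · decide +kernel
end

section
/- Let k ≥ 1 and let W : Fin (3k+2) × Fin 5 → Bool have every filled cell with at most 2 filled orthogonal neighbors. Then the number of filled cells of W is at most (2·5·(3k+2))/3 + 4/3 = 10k + 8. -/
/-- Table of a potential on pairs of consecutive rows (5 bits per pair, 0 means unreachable). -/
def potTable : ℕ := 7640877714382775665371431610387033160632060918647103399609098522981813795658529715548671560488699031666493806184903477348317166534584117319710373842184794586294719545959214975206483962599485312278172258171815005856069952054405025193313301008387948252771280899800609736411074086914470622411473713021260060271409432065714515647719171376342581856610489117173582103398371223393934568344966767237117555716971553795509663658020038627987860917690923479352325608848968012239575281894990710582044418887769571557814208489384184358289601030169993173995499906061569636532834240113538040064893025559690387620462131533651705728407290363939184050262498352417367855068333996775712846895429493070465678866303462997352937826906217417152038259265297968813767618952122840883046884292016601210594494840753915087931006656599081349724019658174376080897388529926018462680664384087693433812823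6267312090237811691195910260726571923693630469197184436092202989982952217816293855271014608860530754528911154528363034032372409226571049240482732667450760448012504613010718807323764016540758250263966063251157303280258974742931879113112772821966982998102551640025084457810054324383800853215077953967099753746057940566539537440395233416109995166673914067821069929218830782115649094897490846647262464597214868516552976877321043929202497355285417403047298919865805159564509795871250420003016255301537330726850927918567143065880958122141392798802346677814108565774072095199187655198010163365459416102134424610863293977813465149820386567442750064594662005988

/-- Potential of the pair of rows `a`, `b` (bit masks below 32). -/
def pot (a b : ℕ) : ℕ := (potTable >>> (5 * (32 * a + b))) % 32

/-- Number of filled cells in a row mask. -/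
def pcnt (m : ℕ) : ℕ := m % 2 + (m / 2) % 2 + (m / 4) % 2 + (m / 8) % 2 + (m / 16) % 2

/-- Mask of the cells of the middle row having at least three filled neighbours. -/
def bad (a b c : ℕ) : ℕ :=
  b &&& (((a &&& c) &&& ((b <<< 1) ||| (b >>> 1))) ||| (((b <<< 1) &&& (b >>> 1)) &&& (a ||| c)))

lemma pot_start : ∀ b < 32, 1 ≤ pot 0 b ∧ 3 * pcnt b + 4 ≤ pot 0 b := by decide +kernel

lemma pot_end : ∀ a < 32, ∀ b < 32, bad a b 0 = 0 → pot a b ≤ 20 := by decide +kernel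

set_option synthInstance.maxSize 2000 in
set_option synthInstance.maxHeartbeats 400000 in
set_option maxRecDepth 100000 in
lemma pot_step : ∀ a < 32, ∀ b < 32, ∀ c < 32, 1 ≤ pot a b → bad a b c = 0 →
    1 ≤ pot b c ∧ pot a b + 3 * pcnt c ≤ pot b c + 10 := by decide +kernel

/-- The word, shifted by one row and padded by empty cells. -/
def ext {n : ℕ} (W : Fin n × Fin 5 → Bool) (i j : ℕ) : Bool :=
  if h : 1 ≤ i ∧ i ≤ n ∧ j < 5 then W (⟨i - 1, by omega⟩, ⟨j, h.2.2⟩) else false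

/-- Row masks of the padded word. -/
def rowm {n : ℕ} (W : Fin n × Fin 5 → Bool) (i : ℕ) : ℕ :=
  Nat.ofBits (fun j : Fin 5 => ext W i j)

lemma rowm_lt {n : ℕ} (W : Fin n × Fin 5 → Bool) (i : ℕ) : rowm W i < 32 :=
  Nat.ofBits_lt_two_pow _

lemma rowm_testBit {n : ℕ} (W : Fin n × Fin 5 → Bool) (i j : ℕ) :
    (rowm W i).testBit j = ext W i j := by
  by_cases hj : j < 5
  · exact Nat.testBit_ofBits_lt _ j hj
  · rw [rowm, Nat.testBit_ofBits_ge _ j (by omega)]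
    simp [ext, hj]

lemma ext_three {n : ℕ} (W : Fin n × Fin 5 → Bool) (hdeg : degLEW W 2)
    (i j : ℕ) (q : Fin 3 → ℕ × ℕ) (hq : Function.Injective q)
    (hadj : ∀ s, ((q s).1 = i ∧ ((q s).2 = j + 1 ∨ (q s).2 + 1 = j)) ∨
      ((q s).2 = j ∧ ((q s).1 = i + 1 ∨ (q s).1 + 1 = i)))
    (h0 : ext W i j = true) (hw : ∀ s, ext W (q s).1 (q s).2 = true) : False := by
  have key : ∀ x y, ext W x y = true → 1 ≤ x ∧ x ≤ n ∧ y < 5 := by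
    intro x y h
    by_contra hc
    simp [ext, hc] at h
  have hb := fun s => key _ _ (hw s)
  have hi := key _ _ h0
  simp only [ext, hi, hb, and_self, dite_true] at h0 hw
  have h2 := hdeg _ h0
  let f : Fin 3 → Fin n × Fin 5 := fun s =>
    (⟨(q s).1 - 1, by have := hb s; omega⟩, ⟨(q s).2, (hb s).2.2⟩)
  have hf : Function.Injective f := by
    intro s t hst
    apply hq
    simp only [f, Prod.mk.injEq, Fin.mk.injEq] at hst
    have := hb s
    have := hb t
    ext <;> omega
  have hsub : Finset.univ.image f ⊆ Finset.univ.filter (fun r =>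
      cellAdj ((⟨i - 1, by omega⟩, ⟨j, hi.2.2⟩) : Fin n × Fin 5) r ∧ W r = true) := by
    intro r hr
    obtain ⟨s, -, rfl⟩ := Finset.mem_image.1 hr
    refine Finset.mem_filter.2 ⟨Finset.mem_univ _, ?_, hw s⟩
    have := hb s
    have := hadj s
    simp only [cellAdj, f, Fin.mk.injEq]
    omega
  have hc := Finset.card_le_card hsub
  rw [Finset.card_image_of_injective _ hf, Finset.card_univ, Fintype.card_fin] at hc
  unfold degW at h2
  omega

lemma bad_zero {n : ℕ} (W : Fin n × Fin 5 → Bool) (hdeg : degLEW W 2) (i : ℕ) :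
    bad (rowm W i) (rowm W (i + 1)) (rowm W (i + 2)) = 0 := by
  apply Nat.eq_of_testBit_eq
  intro j
  have T := fun q => ext_three W hdeg (i + 1) j q
  have t1 := T ![(i, j), (i + 2, j), (i + 1, j + 1)]
  have t2 := T ![(i, j), (i + 2, j), (i + 1, j - 1)]
  have t3 := T ![(i + 1, j + 1), (i + 1, j - 1), (i, j)]
  have t4 := T ![(i + 1, j + 1), (i + 1, j - 1), (i + 2, j)]
  clear T
  simp only [bad, Nat.testBit_and, Nat.testBit_or, Nat.testBit_shiftLeft, Nat.testBit_shiftRight,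
    rowm_testBit, Nat.zero_testBit]
  rw [Bool.eq_false_iff]
  intro h
  simp only [Bool.and_eq_true, Bool.or_eq_true, decide_eq_true_eq, add_comm 1 j] at h
  have inj : ∀ x y z : ℕ × ℕ, x ≠ y → x ≠ z → y ≠ z → Function.Injective ![x, y, z] := by
    intro x y z h1 h2 h3 s t
    fin_cases s <;> fin_cases t <;> simp [h1, h2, h3, h1.symm, h2.symm, h3.symm]
  obtain ⟨hb, ⟨⟨ha, hc⟩, (⟨hj, hl⟩ | hr)⟩ | ⟨⟨⟨hj, hl⟩, hr⟩, (ha | hc)⟩⟩ := h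
  · refine t2 (inj _ _ _ (by simp) (by simp) (by simp)) ?_ hb ?_
    · intro s; fin_cases s <;> simp <;> omega
    · intro s; fin_cases s <;> simpa
  · refine t1 (inj _ _ _ (by simp) (by simp) (by simp)) ?_ hb ?_
    · intro s; fin_cases s <;> simp
    · intro s; fin_cases s <;> simpa
  · refine t3 (inj _ _ _ (by simp; omega) (by simp) (by simp)) ?_ hb ?_
    · intro s; fin_cases s <;> simp <;> omega
    · intro s; fin_cases s <;> simpa
  · refine t4 (inj _ _ _ (by simp; omega) (by simp) (by simp)) ?_ hb ?_
    · intro s; fin_cases s <;> simp <;> omega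
    · intro s; fin_cases s <;> simpa

lemma pot_walk (m : ℕ → ℕ) (hm : ∀ i, m i < 32) (h0 : m 0 = 0)
    (hbad : ∀ i, bad (m i) (m (i + 1)) (m (i + 2)) = 0) (i : ℕ) :
    1 ≤ pot (m i) (m (i + 1)) ∧
    3 * (∑ l ∈ Finset.range (i + 1), pcnt (m (l + 1))) + 14
      ≤ pot (m i) (m (i + 1)) + 10 * (i + 1) := by
  induction i with
  | zero =>
    have := pot_start (m 1) (hm 1)
    simp only [h0, Finset.sum_range_one, zero_add]
    omega
  | succ i ih =>
    have := pot_step _ (hm i) _ (hm (i + 1)) _ (hm (i + 2)) ih.1 (hbad i)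
    rw [Finset.sum_range_succ]
    refine ⟨this.1, ?_⟩
    have h2 := this.2
    have h3 := ih.2
    rw [show i + 1 + 1 = i + 2 from rfl]
    omega

lemma pcnt_rowm {n : ℕ} (W : Fin n × Fin 5 → Bool) (i : Fin n) :
    pcnt (rowm W (i + 1)) = ∑ j : Fin 5, (if W (i, j) = true then 1 else 0) := by
  have hw : ∀ j : Fin 5, (if W (i, j) = true then 1 else 0) = rowm W (i + 1) / 2 ^ j.val % 2 := by
    intro j
    rw [← Nat.toNat_testBit, rowm_testBit]
    have : ext W (i + 1) j = W (i, j) := by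
      simp [ext]
    rw [this]
    cases W (i, j) <;> rfl
  simp only [hw, Fin.sum_univ_five, pcnt]
  simp

lemma count_eq {n : ℕ} (W : Fin n × Fin 5 → Bool) :
    filledCount W = ∑ l ∈ Finset.range n, pcnt (rowm W (l + 1)) := by
  rw [filledCount, Finset.card_filter, Fintype.sum_prod_type, ← Fin.sum_univ_eq_sum_range
    (fun l => pcnt (rowm W (l + 1))) n]
  exact Finset.sum_congr rfl fun i _ => (pcnt_rowm W i).symm

theorem stmt12 (k : ℕ) (hk : 1 ≤ k) (W : Fin (3 * k + 2) × Fin 5 → Bool)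
    (hdeg : degLEW W 2) :
    filledCount W ≤ 10 * k + 8 := by
  have z : ∀ i, (i = 0 ∨ 3 * k + 2 < i) → rowm W i = 0 := by
    intro i hi
    apply Nat.eq_of_testBit_eq
    intro j
    rw [rowm_testBit, Nat.zero_testBit, ext, dif_neg (by omega)]
  have h1 := pot_walk (rowm W) (rowm_lt W) (z 0 (Or.inl rfl)) (bad_zero W hdeg) (3 * k + 1)
  have h2 := bad_zero W hdeg (3 * k + 1)
  rw [z (3 * k + 1 + 2) (by omega)] at h2
  have h3 := pot_end _ (rowm_lt W _) _ (rowm_lt W _) h2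
  rw [count_eq]
  have h4 := h1.2
  change ∑ l ∈ Finset.range (3 * k + 1 + 1), pcnt (rowm W (l + 1)) ≤ 10 * k + 8
  omega
end

section
/- Let W : Fin 3 × Fin 5 → Bool have every filled cell with at most 2 filled orthogonal neighbors and exactly 12 filled cells (excess 2). Then W is unique: it is the word whose first and third rows are fully filled, and whose middle row is filled exactly in the first and last columns. -/
/-- the degree as a sum of indicators over the neighbors -/
lemma degW_eq_sum (W : Fin 3 × Fin 5 → Bool) (p : Fin 3 × Fin 5) :
    degW W p = ∑ q ∈ Finset.univ.filter (fun q => cellAdj p q), (W q).toNat := by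
  unfold degW
  rw [← Finset.filter_filter, Finset.card_filter]
  refine Finset.sum_congr rfl fun q _ => ?_
  cases W q <;> rfl

lemma filledCount_eq_sum (W : Fin 3 × Fin 5 → Bool) :
    filledCount W = ∑ i, ∑ j, (W (i, j)).toNat := by
  unfold filledCount
  rw [Finset.card_filter, Fintype.sum_prod_type]
  refine Finset.sum_congr rfl fun i _ => Finset.sum_congr rfl fun j _ => ?_
  cases W (i, j) <;> rfl

/-- a filled cell whose neighbors are the entries of the list `l` -/
lemma nbr_sum_le (W : Fin 3 × Fin 5 → Bool) (hdeg : degLEW W 2) (p : Fin 3 × Fin 5)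
    (l : List (Fin 3 × Fin 5)) (hl : l.Nodup)
    (h : Finset.univ.filter (fun q => cellAdj p q) = l.toFinset) :
    (W p).toNat = 0 ∨ (l.map fun q => (W q).toNat).sum ≤ 2 := by
  cases hp : W p with
  | false => exact Or.inl rfl
  | true =>
    right
    have h2 := hdeg p hp
    rwa [degW_eq_sum, h, List.sum_toFinset _ hl] at h2

theorem stmt13 (W : Fin 3 × Fin 5 → Bool) (hdeg : degLEW W 2)
    (hcard : filledCount W = 12) :
    ∀ p : Fin 3 × Fin 5,
      W p = true ↔ (p.1.val = 0 ∨ p.1.val = 2 ∨ p.2.val = 0 ∨ p.2.val = 4) := by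
  
  rw [filledCount_eq_sum] at hcard
  simp only [Fin.sum_univ_three, Fin.sum_univ_five] at hcard
  have b00 := Bool.toNat_le (W (0, 0))
  have b01 := Bool.toNat_le (W (0, 1))
  have h01 := nbr_sum_le W hdeg (0, 1) [(0, 0), (0, 2), (1, 1)] (by decide) (by decide)
  have b02 := Bool.toNat_le (W (0, 2))
  have h02 := nbr_sum_le W hdeg (0, 2) [(0, 1), (0, 3), (1, 2)] (by decide) (by decide)
  have b03 := Bool.toNat_le (W (0, 3))
  have h03 := nbr_sum_le W hdeg (0, 3) [(0, 2), (0, 4), (1, 3)] (by decide) (by decide)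
  have b04 := Bool.toNat_le (W (0, 4))
  have b10 := Bool.toNat_le (W (1, 0))
  have h10 := nbr_sum_le W hdeg (1, 0) [(0, 0), (1, 1), (2, 0)] (by decide) (by decide)
  have b11 := Bool.toNat_le (W (1, 1))
  have h11 := nbr_sum_le W hdeg (1, 1) [(0, 1), (1, 0), (1, 2), (2, 1)] (by decide) (by decide)
  have b12 := Bool.toNat_le (W (1, 2))
  have h12 := nbr_sum_le W hdeg (1, 2) [(0, 2), (1, 1), (1, 3), (2, 2)] (by decide) (by decide)
  have b13 := Bool.toNat_le (W (1, 3))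
  have h13 := nbr_sum_le W hdeg (1, 3) [(0, 3), (1, 2), (1, 4), (2, 3)] (by decide) (by decide)
  have b14 := Bool.toNat_le (W (1, 4))
  have h14 := nbr_sum_le W hdeg (1, 4) [(0, 4), (1, 3), (2, 4)] (by decide) (by decide)
  have b20 := Bool.toNat_le (W (2, 0))
  have b21 := Bool.toNat_le (W (2, 1))
  have h21 := nbr_sum_le W hdeg (2, 1) [(1, 1), (2, 0), (2, 2)] (by decide) (by decide)
  have b22 := Bool.toNat_le (W (2, 2))
  have h22 := nbr_sum_le W hdeg (2, 2) [(1, 2), (2, 1), (2, 3)] (by decide) (by decide)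
  have b23 := Bool.toNat_le (W (2, 3))
  have h23 := nbr_sum_le W hdeg (2, 3) [(1, 3), (2, 2), (2, 4)] (by decide) (by decide)
  have b24 := Bool.toNat_le (W (2, 4))
  clear hdeg
  simp only [List.map_cons, List.map_nil, List.sum_cons, List.sum_nil] at h01 h02 h03 h10 h11 h12 h13 h14 h21 h22 h23
  have main : (W (0, 0)).toNat = 1 ∧ (W (0, 1)).toNat = 1 ∧ (W (0, 2)).toNat = 1 ∧ (W (0, 3)).toNat = 1 ∧ (W (0, 4)).toNat = 1 ∧ (W (1, 0)).toNat = 1 ∧ (W (1, 1)).toNat = 0 ∧ (W (1, 2)).toNat = 0 ∧ (W (1, 3)).toNat = 0 ∧ (W (1, 4)).toNat = 1 ∧ (W (2, 0)).toNat = 1 ∧ (W (2, 1)).toNat = 1 ∧ (W (2, 2)).toNat = 1 ∧ (W (2, 3)).toNat = 1 ∧ (W (2, 4)).toNat = 1 := by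
    generalize (W (0, 0)).toNat = x00 at *
    generalize (W (0, 1)).toNat = x01 at *
    generalize (W (0, 2)).toNat = x02 at *
    generalize (W (0, 3)).toNat = x03 at *
    generalize (W (0, 4)).toNat = x04 at *
    generalize (W (1, 0)).toNat = x10 at *
    generalize (W (1, 1)).toNat = x11 at *
    generalize (W (1, 2)).toNat = x12 at *
    generalize (W (1, 3)).toNat = x13 at *
    generalize (W (1, 4)).toNat = x14 at *
    generalize (W (2, 0)).toNat = x20 at *
    generalize (W (2, 1)).toNat = x21 at *
    generalize (W (2, 2)).toNat = x22 at *
    generalize (W (2, 3)).toNat = x23 at *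
    generalize (W (2, 4)).toNat = x24 at *
    omega
  simp only [Bool.toNat_eq_one, Bool.toNat_eq_zero] at main
  rintro ⟨i, j⟩
  fin_cases i <;> fin_cases j <;> simp [main]
end

section
/- Let h ≥ 3 and let W : Fin h × Fin 3 → Bool be a word with every filled cell of degree at most 2, with exactly 2h + 2 filled cells (i.e., W is 2-full), and with no empty row (W is atomic). Then the first row of W is fully filled, the second row is filled exactly at its first and third cells, and every row other than the first and last contains exactly 2 filled cells. -/
/-- reflect a coordinate if the flag is set -/
def flipCoord {n : ℕ} (b : Bool) (i : Fin n) : Fin n :=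
  if b then ⟨n - 1 - i.val, by have := i.isLt; omega⟩ else i

/-- rows of width three -/
abbrev Row3 := Bool × Bool × Bool

def rowCount (a : Row3) : ℤ := a.1.toNat + a.2.1.toNat + a.2.2.toNat

def rowCode (a : Row3) : ℕ := a.1.toNat + 2 * a.2.1.toNat + 4 * a.2.2.toNat

/-- the middle row of three consecutive rows satisfies the degree condition -/
def okRow (a b c : Row3) : Bool :=
  !(b.1 && a.1 && c.1 && b.2.1) && !(b.2.2 && a.2.2 && c.2.2 && b.2.1) &&
  !(b.2.1 && a.2.1 && c.2.1 && b.1) && !(b.2.1 && a.2.1 && c.2.1 && b.2.2) &&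
  !(b.2.1 && a.2.1 && b.1 && b.2.2) && !(b.2.1 && c.2.1 && b.1 && b.2.2)

/-- maximal excess over two cells per row of a prefix that is already bad,
as a function of its last two rows -/
def badPot (a b : Row3) : ℤ :=
  (([[-9, -9, -9, -9, -9, -9, -9, -9], [-9, -1, -1, 0, -1, 0, 0, 1],
    [-9, -1, -1, 0, -1, 0, 0, 1], [-9, 0, 0, 0, 0, 0, 0, 1],
    [-9, -1, -1, 0, -1, 0, 0, 1], [-9, 0, 0, 0, 0, 0, 0, 2],
    [-9, 0, 0, 0, 0, 0, 0, 1], [-9, 0, -9, -9, 0, -9, -9, -9]] : List (List ℤ)).getD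
      (rowCode a) []).getD (rowCode b) (-9)

def goodPair (a b : Row3) : Bool :=
  (rowCode a, rowCode b) ∈
    ([(3, 5), (3, 6), (5, 3), (5, 5), (5, 6), (6, 3), (6, 5), (7, 5)] : List (ℕ × ℕ))

def emptyRow : Row3 := (false, false, false)

set_option maxRecDepth 100000 in
set_option synthInstance.maxHeartbeats 400000 in
set_option synthInstance.maxSize 4096 in
lemma base_step : ∀ a b : Row3, a ≠ emptyRow → b ≠ emptyRow → okRow emptyRow a b = true →
    (a = (true, true, true) ∧ b = (true, false, true)) ∨
      rowCount a + rowCount b - 4 ≤ badPot a b := by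
  decide

set_option maxRecDepth 100000 in
set_option synthInstance.maxHeartbeats 400000 in
set_option synthInstance.maxSize 4096 in
set_option maxHeartbeats 4000000 in
lemma bad_step : ∀ a b c : Row3, a ≠ emptyRow → b ≠ emptyRow → c ≠ emptyRow →
    okRow a b c = true → badPot a b + rowCount c - 2 ≤ badPot b c := by
  decide

set_option maxRecDepth 100000 in
set_option synthInstance.maxHeartbeats 400000 in
set_option synthInstance.maxSize 4096 in
set_option maxHeartbeats 4000000 in
lemma good_step : ∀ a b c : Row3, c ≠ emptyRow → goodPair a b = true →
    okRow a b c = true →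
    (rowCount c = 2 ∧ goodPair b c = true) ∨ 1 + rowCount c - 2 ≤ badPot b c := by
  decide

set_option maxRecDepth 100000 in
set_option synthInstance.maxHeartbeats 400000 in
set_option synthInstance.maxSize 4096 in
set_option maxHeartbeats 4000000 in
lemma final_step : ∀ a b c : Row3, a ≠ emptyRow → b ≠ emptyRow → c ≠ emptyRow →
    okRow a b c = true → okRow b c emptyRow = true →
    badPot a b + rowCount c - 2 ≤ 1 := by
  decide

lemma rows_main (h : ℕ) (hh : 3 ≤ h) (r : ℕ → Row3)
    (hne : ∀ i < h, r i ≠ emptyRow) (hend : r h = emptyRow)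
    (h0 : okRow emptyRow (r 0) (r 1) = true)
    (hok : ∀ i, i + 2 ≤ h → okRow (r i) (r (i + 1)) (r (i + 2)) = true)
    (hsum : ∑ i ∈ Finset.range h, rowCount (r i) = 2 * h + 2) :
    r 0 = (true, true, true) ∧ r 1 = (true, false, true) ∧
      ∀ i, 0 < i → i < h - 1 → rowCount (r i) = 2 := by
  have inv : ∀ k, k + 2 ≤ h →
      (r 0 = (true, true, true) ∧ r 1 = (true, false, true) ∧
        (∀ i, 0 < i → i < k + 2 → rowCount (r i) = 2) ∧
        goodPair (r k) (r (k + 1)) = true ∧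
        ∑ i ∈ Finset.range (k + 2), rowCount (r i) - 2 * ((k : ℤ) + 2) ≤ 1) ∨
      ∑ i ∈ Finset.range (k + 2), rowCount (r i) - 2 * ((k : ℤ) + 2) ≤
        badPot (r k) (r (k + 1)) := by
    intro k
    induction k with
    | zero =>
      intro _
      rcases base_step (r 0) (r 1) (hne 0 (by omega)) (hne 1 (by omega)) h0 with ⟨ha, hb⟩ | hb
      · left
        refine ⟨ha, hb, ?_, ?_, ?_⟩
        · intro i hi hi2
          obtain rfl : i = 1 := by omega
          rw [hb]; decide
        · rw [ha, hb]; decide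
        · simp only [Finset.sum_range_succ, Finset.sum_range_zero, ha, hb]; decide
      · right
        simp only [Finset.sum_range_succ, Finset.sum_range_zero]
        push_cast
        linarith
    | succ k ih =>
      intro hk
      have ok := hok k (by omega)
      rw [Finset.sum_range_succ]
      push_cast
      rcases ih (by omega) with ⟨ha, hb, hc, hg, he⟩ | he
      · rcases good_step _ _ _ (hne (k + 2) (by omega)) hg ok with ⟨h1, h2⟩ | h1
        · left
          refine ⟨ha, hb, ?_, h2, ?_⟩
          · intro i hi hi2
            rcases Nat.lt_or_ge i (k + 2) with h3 | h3
            · exact hc i hi h3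
            · obtain rfl : i = k + 2 := by omega
              exact h1
          · linarith
        · right
          have e : k + 1 + 1 = k + 2 := rfl
          rw [e]
          linarith
      · right
        have := bad_step _ _ _ (hne k (by omega)) (hne (k + 1) (by omega))
          (hne (k + 2) (by omega)) ok
        have e : k + 1 + 1 = k + 2 := rfl
        rw [e]
        linarith
  obtain ⟨k, rfl⟩ : ∃ k, h = k + 3 := ⟨h - 3, by omega⟩
  rcases inv k (by omega) with ⟨ha, hb, hc, -, -⟩ | he
  · exact ⟨ha, hb, fun i hi hi2 => hc i hi (by omega)⟩
  · exfalso
    have o2 := hok (k + 1) (by omega)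
    have e : k + 1 + 2 = k + 3 := rfl
    rw [e, hend] at o2
    have := final_step _ _ _ (hne k (by omega)) (hne (k + 1) (by omega))
      (hne (k + 2) (by omega)) (hok k (by omega)) o2
    rw [Finset.sum_range_succ] at hsum
    push_cast at hsum
    linarith

lemma three_nbrs {h : ℕ} (W : Fin h × Fin 3 → Bool) (hdeg : degLEW W 2)
    (p q₁ q₂ q₃ : Fin h × Fin 3) (hp : W p = true)
    (h1 : W q₁ = true) (h2 : W q₂ = true) (h3 : W q₃ = true)
    (a1 : cellAdj p q₁) (a2 : cellAdj p q₂) (a3 : cellAdj p q₃)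
    (n12 : q₁ ≠ q₂) (n13 : q₁ ≠ q₃) (n23 : q₂ ≠ q₃) : False := by
  have hd := hdeg p hp
  have hs : ({q₁, q₂, q₃} : Finset (Fin h × Fin 3)) ⊆
      Finset.univ.filter (fun q => cellAdj p q ∧ W q = true) := by
    intro q hq
    simp only [Finset.mem_insert, Finset.mem_singleton] at hq
    rw [Finset.mem_filter]
    rcases hq with rfl | rfl | rfl
    · exact ⟨Finset.mem_univ _, a1, h1⟩
    · exact ⟨Finset.mem_univ _, a2, h2⟩
    · exact ⟨Finset.mem_univ _, a3, h3⟩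
  have hc := Finset.card_le_card hs
  rw [Finset.card_eq_three.mpr ⟨q₁, q₂, q₃, n12, n13, n23, rfl⟩] at hc
  unfold degW at hd
  omega

/-- cell with default value outside of the grid -/
def cellAt {h : ℕ} (W : Fin h × Fin 3 → Bool) (i : ℕ) (j : Fin 3) : Bool :=
  if hi : i < h then W (⟨i, hi⟩, j) else false

lemma cellAt_true {h : ℕ} {W : Fin h × Fin 3 → Bool} {i : ℕ} {j : Fin 3}
    (hx : cellAt W i j = true) : ∃ hi : i < h, W (⟨i, hi⟩, j) = true := by
  unfold cellAt at hx
  split at hx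
  · exact ⟨_, hx⟩
  · simp at hx

def rowAt {h : ℕ} (W : Fin h × Fin 3 → Bool) (i : ℕ) : Row3 :=
  (cellAt W i 0, cellAt W i 1, cellAt W i 2)

lemma three_cells {h : ℕ} (W : Fin h × Fin 3 → Bool) (hdeg : degLEW W 2)
    (i i₁ i₂ i₃ : ℕ) (j j₁ j₂ j₃ : Fin 3)
    (hp : cellAt W i j = true) (h1 : cellAt W i₁ j₁ = true) (h2 : cellAt W i₂ j₂ = true)
    (h3 : cellAt W i₃ j₃ = true)
    (a1 : (i = i₁ ∧ (j.val + 1 = j₁.val ∨ j₁.val + 1 = j.val)) ∨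
      (j = j₁ ∧ (i + 1 = i₁ ∨ i₁ + 1 = i)))
    (a2 : (i = i₂ ∧ (j.val + 1 = j₂.val ∨ j₂.val + 1 = j.val)) ∨
      (j = j₂ ∧ (i + 1 = i₂ ∨ i₂ + 1 = i)))
    (a3 : (i = i₃ ∧ (j.val + 1 = j₃.val ∨ j₃.val + 1 = j.val)) ∨
      (j = j₃ ∧ (i + 1 = i₃ ∨ i₃ + 1 = i)))
    (n12 : ¬ (i₁ = i₂ ∧ j₁ = j₂)) (n13 : ¬ (i₁ = i₃ ∧ j₁ = j₃))
    (n23 : ¬ (i₂ = i₃ ∧ j₂ = j₃)) : False := by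
  obtain ⟨b, hp⟩ := cellAt_true hp
  obtain ⟨b1, h1⟩ := cellAt_true h1
  obtain ⟨b2, h2⟩ := cellAt_true h2
  obtain ⟨b3, h3⟩ := cellAt_true h3
  refine three_nbrs W hdeg _ _ _ _ hp h1 h2 h3 ?_ ?_ ?_ ?_ ?_ ?_
  · simpa [cellAdj] using a1
  · simpa [cellAdj] using a2
  · simpa [cellAdj] using a3
  · simpa using n12
  · simpa using n13
  · simpa using n23

lemma okRow_of {a b c : Row3}
    (h1 : b.1 = true → a.1 = true → c.1 = true → b.2.1 = true → False)
    (h2 : b.2.2 = true → a.2.2 = true → c.2.2 = true → b.2.1 = true → False)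
    (h3 : b.2.1 = true → a.2.1 = true → c.2.1 = true → b.1 = true → False)
    (h4 : b.2.1 = true → a.2.1 = true → c.2.1 = true → b.2.2 = true → False)
    (h5 : b.2.1 = true → a.2.1 = true → b.1 = true → b.2.2 = true → False)
    (h6 : b.2.1 = true → c.2.1 = true → b.1 = true → b.2.2 = true → False) :
    okRow a b c = true := by
  simp only [okRow, Bool.and_eq_true, Bool.not_eq_true', ← Bool.not_eq_true]
  exact ⟨⟨⟨⟨⟨fun x => h1 x.1.1.1 x.1.1.2 x.1.2 x.2, fun x => h2 x.1.1.1 x.1.1.2 x.1.2 x.2⟩,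
    fun x => h3 x.1.1.1 x.1.1.2 x.1.2 x.2⟩, fun x => h4 x.1.1.1 x.1.1.2 x.1.2 x.2⟩,
    fun x => h5 x.1.1.1 x.1.1.2 x.1.2 x.2⟩, fun x => h6 x.1.1.1 x.1.1.2 x.1.2 x.2⟩

lemma rowAt_ok {h : ℕ} (W : Fin h × Fin 3 → Bool) (hdeg : degLEW W 2) (i : ℕ) :
    okRow (rowAt W i) (rowAt W (i + 1)) (rowAt W (i + 2)) = true := by
  apply okRow_of <;> intro x0 x1 x2 x3 <;>
    exact three_cells W hdeg _ _ _ _ _ _ _ _ x0 x1 x2 x3 (by simp) (by simp) (by simp)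
      (by simp) (by simp) (by simp)

lemma rowAt_ok0 {h : ℕ} (W : Fin h × Fin 3 → Bool) (hdeg : degLEW W 2) :
    okRow emptyRow (rowAt W 0) (rowAt W 1) = true := by
  apply okRow_of <;> intro x0 x1 x2 x3
  case h6 =>
    exact three_cells W hdeg _ _ _ _ _ _ _ _ x0 x1 x2 x3 (by simp) (by simp) (by simp)
      (by simp) (by simp) (by simp)
  all_goals simp [emptyRow] at x1

lemma rowCount_rowAt {h : ℕ} (W : Fin h × Fin 3 → Bool) (i : Fin h) :
    rowCount (rowAt W i) =
      ((Finset.univ.filter (fun j : Fin 3 => W (i, j) = true)).card : ℤ) := by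
  rw [Finset.card_filter, Fin.sum_univ_three]
  simp only [rowCount, rowAt, cellAt, i.isLt, dif_pos, Fin.eta]
  cases W (i, 0) <;> cases W (i, 1) <;> cases W (i, 2) <;> rfl

lemma filledCount_eq {h : ℕ} (W : Fin h × Fin 3 → Bool) :
    (filledCount W : ℤ) = ∑ i ∈ Finset.range h, rowCount (rowAt W i) := by
  rw [Finset.sum_range]
  simp only [rowCount_rowAt]
  unfold filledCount
  rw [Finset.card_filter, Fintype.sum_prod_type]
  push_cast [Finset.card_filter]
  rfl

theorem stmt19 (h : ℕ) (hh : 3 ≤ h) (W : Fin h × Fin 3 → Bool)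
    (hdeg : degLEW W 2) (hcard : filledCount W = 2 * h + 2)
    (hatomic : ∀ i : Fin h, ∃ j : Fin 3, W (i, j) = true) :
    ∃ fv fh : Bool, ∃ W' : Fin h × Fin 3 → Bool,
      (∀ p : Fin h × Fin 3, W' p = W (flipCoord fv p.1, flipCoord fh p.2)) ∧
      (∀ j : Fin 3, W' (⟨0, by omega⟩, j) = true) ∧
      (∀ j : Fin 3, W' (⟨1, by omega⟩, j) = true ↔ (j.val = 0 ∨ j.val = 2)) ∧
      (∀ i : Fin h, 0 < i.val → i.val < h - 1 →
        (Finset.univ.filter (fun j : Fin 3 => W' (i, j) = true)).card = 2) := by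
  have hne : ∀ i < h, rowAt W i ≠ emptyRow := by
    intro i hi he
    obtain ⟨j, hj⟩ := hatomic ⟨i, hi⟩
    simp only [rowAt, emptyRow, cellAt, hi, dif_pos, Prod.mk.injEq] at he
    obtain ⟨e0, e1, e2⟩ := he
    fin_cases j
    · exact absurd (hj.symm.trans e0) (by decide)
    · exact absurd (hj.symm.trans e1) (by decide)
    · exact absurd (hj.symm.trans e2) (by decide)
  have hend : rowAt W h = emptyRow := by simp [rowAt, cellAt, emptyRow]
  have hsum := filledCount_eq W
  rw [hcard] at hsum
  push_cast at hsum
  obtain ⟨r0, r1, r2⟩ := rows_main h hh (rowAt W) hne hend (rowAt_ok0 W hdeg)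
    (fun i _ => rowAt_ok W hdeg i) hsum.symm
  have p0 : 0 < h := by omega
  have p1 : 1 < h := by omega
  simp only [rowAt, cellAt, p0, p1, dif_pos, Prod.mk.injEq] at r0 r1
  obtain ⟨r00, r01, r02⟩ := r0
  obtain ⟨r10, r11, r12⟩ := r1
  refine ⟨false, false, W, fun p => by simp [flipCoord], ?_, ?_, ?_⟩
  · intro j
    fin_cases j
    · exact r00
    · exact r01
    · exact r02
  · intro j
    fin_cases j
    · simpa using r10
    · simpa using r11
    · simpa using r12
  · intro i hi hi2
    have := r2 i hi hi2
    rw [rowCount_rowAt] at this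
    exact_mod_cast this
end
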